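/- Let {x^{(k)}} satisfy the scaled ε-subgradient iteration x^{(k+1)} = P_{X,D_k^{-1}}(x^{(k)} − (α_k / max(1, ||u^{(k)}||_{D_k})) D_k u^{(k)}) with u^{(k)} ∈ ∂_{ε_k} f(x^{(k)}), ||u^{(k)}|| ≤ ρ, ||D_k||, ||D_k^{-1}|| ≤ L_k = sqrt(1+γ_k) ≤ L, Σγ_k < ∞. If ε_k → 0, Σ α_k = ∞, Σ α_k^2 < ∞, and Σ α_k ε_k < ∞, then {x^{(k)}} converges to a minimizer of f over X, assuming X* ≠ ∅. -/

import Mathlib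

open Matrix

lemma rs_conv (a b γ η : ℕ → ℝ) (ha : ∀ k, 0 ≤ a k) (hb : ∀ k, 0 ≤ b k)
    (hγ : ∀ k, 0 ≤ γ k) (hη : ∀ k, 0 ≤ η k) (sγ : Summable γ) (sη : Summable η)
    (h : ∀ k, a (k + 1) ≤ (1 + γ k) * a k + η k - b k) :
    (∃ l, Filter.Tendsto a Filter.atTop (nhds l)) ∧ Summable b := by
  have hbd : ∀ k, a k ≤ Real.exp (∑ i ∈ Finset.range k, γ i) *
      (a 0 + ∑ i ∈ Finset.range k, η i) := by
    intro k
    induction k with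
    | zero => simp
    | succ k ih =>
      rw [Finset.sum_range_succ, Finset.sum_range_succ, Real.exp_add]
      set S := ∑ i ∈ Finset.range k, γ i
      set H := ∑ i ∈ Finset.range k, η i
      have hS : 0 ≤ S := Finset.sum_nonneg fun i _ => hγ i
      have hH : 0 ≤ H := Finset.sum_nonneg fun i _ => hη i
      have e1 : 1 ≤ Real.exp S := Real.one_le_exp hS
      have e2 : 1 + γ k ≤ Real.exp (γ k) := by linarith [Real.add_one_le_exp (γ k)]
      have e3 : 1 ≤ Real.exp S * Real.exp (γ k) := by
        nlinarith [hγ k]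
      have h0 := ha 0
      have hG : 0 ≤ Real.exp S * (a 0 + H) := by positivity
      calc a (k + 1) ≤ (1 + γ k) * a k + η k := by linarith [h k, hb k]
        _ ≤ (1 + γ k) * (Real.exp S * (a 0 + H)) + η k := by
            have := mul_le_mul_of_nonneg_left ih (by linarith [hγ k] : 0 ≤ 1 + γ k)
            linarith
        _ ≤ Real.exp (γ k) * (Real.exp S * (a 0 + H)) + Real.exp S * Real.exp (γ k) * η k := by
            have := mul_le_mul_of_nonneg_right e2 hG
            have := mul_le_mul_of_nonneg_right e3 (hη k)
            linarith
        _ = _ := by ring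
  obtain ⟨M, hM0, hM⟩ : ∃ M, 0 ≤ M ∧ ∀ k, a k ≤ M := by
    have hH : 0 ≤ ∑' i, η i := tsum_nonneg hη
    have h0 := ha 0
    refine ⟨Real.exp (∑' i, γ i) * (a 0 + ∑' i, η i), by positivity, fun k => (hbd k).trans ?_⟩
    have h1 := sγ.sum_le_tsum (Finset.range k) (fun i _ => hγ i)
    have h2 := sη.sum_le_tsum (Finset.range k) (fun i _ => hη i)
    have h3 : 0 ≤ ∑ i ∈ Finset.range k, η i := Finset.sum_nonneg fun i _ => hη i
    gcongr
  set θ : ℕ → ℝ := fun k => γ k * M + η k with hθ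
  have sθ : Summable θ := (sγ.mul_right M).add sη
  have θ0 : ∀ k, 0 ≤ θ k := fun k => add_nonneg (mul_nonneg (hγ k) hM0) (hη k)
  have step : ∀ k, a (k + 1) ≤ a k + θ k - b k := by
    intro k
    have := mul_le_mul_of_nonneg_left (hM k) (hγ k)
    have := h k
    simp only [hθ]; linarith
  have hbs : ∀ k, a k + ∑ i ∈ Finset.range k, b i ≤ a 0 + ∑ i ∈ Finset.range k, θ i := by
    intro k
    induction k with
    | zero => simp
    | succ k ih =>
      rw [Finset.sum_range_succ, Finset.sum_range_succ]
      linarith [step k]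
  constructor
  · have hanti : Antitone (fun k => a k - ∑ i ∈ Finset.range k, θ i) := by
      apply antitone_nat_of_succ_le
      intro k
      rw [Finset.sum_range_succ]
      linarith [step k, hb k]
    have hbb : BddBelow (Set.range (fun k => a k - ∑ i ∈ Finset.range k, θ i)) := by
      refine ⟨-∑' i, θ i, ?_⟩
      rintro _ ⟨k, rfl⟩
      have := sθ.sum_le_tsum (Finset.range k) (fun i _ => θ0 i)
      have := ha k
      simp only; linarith
    have t1 := tendsto_atTop_ciInf hanti hbb
    have t2 := t1.add sθ.hasSum.tendsto_sum_nat
    refine ⟨_, t2.congr fun k => by ring⟩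
  · apply summable_of_sum_range_le (c := a 0 + ∑' i, θ i) hb
    intro k
    have := sθ.sum_le_tsum (Finset.range k) (fun i _ => θ0 i)
    linarith [hbs k, ha k]

lemma freq_small (α g : ℕ → ℝ) (hα : ∀ k, 0 < α k) (hg : ∀ k, 0 ≤ g k)
    (hdiv : Filter.Tendsto (fun N => ∑ k ∈ Finset.range N, α k) Filter.atTop Filter.atTop)
    (hs : Summable (fun k => α k * g k)) (δ : ℝ) (hδ : 0 < δ) (N : ℕ) :
    ∃ k, N ≤ k ∧ g k < δ := by
  by_contra! hcon
  have hs1 : Summable (fun k => α (k + N)) := by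
    have h2 : Summable (fun k => δ⁻¹ * (α (k + N) * g (k + N))) :=
      ((summable_nat_add_iff (f := fun k => α k * g k) N).2 hs).mul_left _
    refine Summable.of_nonneg_of_le (fun k => (hα _).le) (fun k => ?_) h2
    have h3 := hcon (k + N) (by omega)
    have h4 := mul_le_mul_of_nonneg_left h3 (hα (k + N)).le
    rw [inv_mul_eq_div, le_div_iff₀ hδ]
    exact h4
  have hs2 : Summable α := (summable_nat_add_iff N).1 hs1
  exact not_tendsto_nhds_of_tendsto_atTop hdiv _ hs2.hasSum.tendsto_sum_nat

lemma symm_dot {n : ℕ} (M : Matrix (Fin n) (Fin n) ℝ) (hM : Mᵀ = M) (v w : Fin n → ℝ) :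
    v ⬝ᵥ M.mulVec w = w ⬝ᵥ M.mulVec v := by
  rw [dotProduct_mulVec, ← mulVec_transpose, hM, dotProduct_comm]

lemma quad_sub {n : ℕ} (M : Matrix (Fin n) (Fin n) ℝ) (hM : Mᵀ = M) (v w : Fin n → ℝ) (t : ℝ) :
    (v - t • w) ⬝ᵥ M.mulVec (v - t • w) =
      v ⬝ᵥ M.mulVec v - 2 * t * (w ⬝ᵥ M.mulVec v) + t ^ 2 * (w ⬝ᵥ M.mulVec w) := by
  have := symm_dot M hM v w
  simp only [mulVec_sub, mulVec_smul, sub_dotProduct, dotProduct_sub, smul_dotProduct,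
    dotProduct_smul, smul_eq_mul]
  rw [this]; ring

lemma proj_nonexp {n : ℕ} (M : Matrix (Fin n) (Fin n) ℝ) (hM : Mᵀ = M)
    (hpos : ∀ v : Fin n → ℝ, 0 ≤ v ⬝ᵥ M.mulVec v)
    (X : Set (Fin n → ℝ)) (hX : Convex ℝ X) (y p z : Fin n → ℝ) (hp : p ∈ X) (hz : z ∈ X)
    (h : ∀ w ∈ X, (y - p) ⬝ᵥ M.mulVec (y - p) ≤ (y - w) ⬝ᵥ M.mulVec (y - w)) :
    (p - z) ⬝ᵥ M.mulVec (p - z) ≤ (y - z) ⬝ᵥ M.mulVec (y - z) := by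
  set B := (z - p) ⬝ᵥ M.mulVec (y - p) with hB
  set Q := (z - p) ⬝ᵥ M.mulVec (z - p) with hQ
  have hQ0 : 0 ≤ Q := hpos _
  have key : ∀ t : ℝ, 0 < t → t ≤ 1 → 2 * B ≤ t * Q := by
    intro t ht ht1
    have h1 := h (p + t • (z - p)) (hX.add_smul_sub_mem hp hz ⟨ht.le, ht1⟩)
    have e : y - (p + t • (z - p)) = (y - p) - t • (z - p) := by abel
    rw [e, quad_sub M hM] at h1
    have : t * (2 * B) ≤ t * (t * Q) := by nlinarith
    exact le_of_mul_le_mul_left this ht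
  have hB0 : B ≤ 0 := by
    by_contra! hcon
    have h1 := key (B / (B + Q)) (by positivity) (by rw [div_le_one (by positivity)]; linarith)
    have h2 : B / (B + Q) * Q ≤ B := by
      rw [div_mul_eq_mul_div, div_le_iff₀ (by positivity)]; nlinarith
    linarith
  have e1 := quad_sub M hM (y - p) (z - p) 1
  have e2 : (y - p) - (1 : ℝ) • (z - p) = y - z := by rw [one_smul]; abel
  have e3 : (p - z) ⬝ᵥ M.mulVec (p - z) = Q := by
    rw [hQ, ← neg_sub z p, mulVec_neg, neg_dotProduct_neg]
  rw [e2] at e1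
  rw [e1, e3]
  have := hpos (y - p)
  linarith

lemma inv_bounds {n : ℕ} (D : Matrix (Fin n) (Fin n) ℝ) (hD : D.PosDef) (L : ℝ) (hL : 1 ≤ L)
    (hub : ∀ v : Fin n → ℝ, v ⬝ᵥ D.mulVec v ≤ L * (v ⬝ᵥ v))
    (hlb : ∀ v : Fin n → ℝ, v ⬝ᵥ v ≤ L * (v ⬝ᵥ D.mulVec v)) (v : Fin n → ℝ) :
    v ⬝ᵥ D⁻¹.mulVec v ≤ L * (v ⬝ᵥ v) ∧ v ⬝ᵥ v ≤ L * (v ⬝ᵥ D⁻¹.mulVec v) := by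
  have hT : Dᵀ = D := by rw [← conjTranspose_eq_transpose_of_trivial]; exact hD.isHermitian.eq
  have hu : IsUnit D.det := hD.det_pos.ne'.isUnit
  set w := D⁻¹.mulVec v with hw
  have hDw : D.mulVec w = v := by rw [hw, mulVec_mulVec, mul_nonsing_inv _ hu, one_mulVec]
  have hpos : ∀ v : Fin n → ℝ, 0 ≤ v ⬝ᵥ D.mulVec v := fun v => by
    simpa using hD.posSemidef.dotProduct_mulVec_nonneg v
  have hL0 : 0 < L := by linarith
  constructor
  · have h1 : 0 ≤ (w - L • v) ⬝ᵥ (w - L • v) := by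
      simpa using dotProduct_star_self_nonneg (w - L • v)
    have h2 := quad_sub 1 (by simp) w v L
    simp only [one_mulVec] at h2
    have h3 := hlb w
    rw [hDw, dotProduct_comm w v] at h3
    rw [h2] at h1
    have : L * (v ⬝ᵥ w) ≤ L * (L * (v ⬝ᵥ v)) := by nlinarith
    exact le_of_mul_le_mul_left this hL0
  · have h1 := hpos (w - L⁻¹ • v)
    rw [quad_sub D hT, hDw, dotProduct_comm w v] at h1
    have h3 := mul_le_mul_of_nonneg_left (hub v) (sq_nonneg L⁻¹)
    have h4 : L⁻¹ ^ 2 * (L * (v ⬝ᵥ v)) = L⁻¹ * (v ⬝ᵥ v) := by field_simp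
    have h5 : L⁻¹ * (v ⬝ᵥ v) ≤ v ⬝ᵥ w := by linarith
    rwa [inv_mul_le_iff₀ hL0] at h5

lemma step_ineq {n : ℕ} (D : Matrix (Fin n) (Fin n) ℝ) (hD : D.PosDef) (L : ℝ) (hL : 1 ≤ L)
    (hub : ∀ v : Fin n → ℝ, v ⬝ᵥ D.mulVec v ≤ L * (v ⬝ᵥ v))
    (hlb : ∀ v : Fin n → ℝ, v ⬝ᵥ v ≤ L * (v ⬝ᵥ D.mulVec v))
    (X : Set (Fin n → ℝ)) (hX : Convex ℝ X) (x u p z : Fin n → ℝ) (hp : p ∈ X) (hz : z ∈ X)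
    (α m ε g : ℝ) (hα : 0 < α) (hm : m = max 1 (Real.sqrt (u ⬝ᵥ D.mulVec u)))
    (hg : 0 ≤ g) (hε : 0 ≤ ε) (hu : g - ε ≤ u ⬝ᵥ (x - z))
    (h : ∀ w ∈ X, ((x - (α / m) • D.mulVec u) - p) ⬝ᵥ D⁻¹.mulVec ((x - (α / m) • D.mulVec u) - p) ≤
      ((x - (α / m) • D.mulVec u) - w) ⬝ᵥ D⁻¹.mulVec ((x - (α / m) • D.mulVec u) - w)) :
    (p - z) ⬝ᵥ (p - z) ≤ L ^ 2 * ((x - z) ⬝ᵥ (x - z)) + L * (2 * (α * ε) + α ^ 2)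
      - 2 * (α / m) * g := by
  have hT : Dᵀ = D := by rw [← conjTranspose_eq_transpose_of_trivial]; exact hD.isHermitian.eq
  have hun : IsUnit D.det := hD.det_pos.ne'.isUnit
  have hI := hD.inv
  have hIT : (D⁻¹)ᵀ = D⁻¹ := by rw [← conjTranspose_eq_transpose_of_trivial]; exact hI.isHermitian.eq
  have hpos : ∀ v : Fin n → ℝ, 0 ≤ v ⬝ᵥ D⁻¹.mulVec v := fun v => by
    simpa using hI.posSemidef.dotProduct_mulVec_nonneg v
  have hDpos : 0 ≤ u ⬝ᵥ D.mulVec u := by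
    simpa using hD.posSemidef.dotProduct_mulVec_nonneg u
  have h1 := proj_nonexp D⁻¹ hIT hpos X hX _ p z hp hz h
  have e : (x - (α / m) • D.mulVec u) - z = (x - z) - (α / m) • D.mulVec u := by abel
  have e2 : D⁻¹.mulVec (D.mulVec u) = u := by
    rw [mulVec_mulVec, nonsing_inv_mul _ hun, one_mulVec]
  rw [e, quad_sub D⁻¹ hIT, symm_dot D⁻¹ hIT (D.mulVec u) (x - z), e2,
    dotProduct_comm _ u, dotProduct_comm _ u] at h1
  have hm1 : 1 ≤ m := hm ▸ le_max_left _ _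
  have hm2 : u ⬝ᵥ D.mulVec u ≤ m ^ 2 := by
    have : Real.sqrt (u ⬝ᵥ D.mulVec u) ≤ m := hm ▸ le_max_right _ _
    calc _ = Real.sqrt (u ⬝ᵥ D.mulVec u) ^ 2 := (Real.sq_sqrt hDpos).symm
      _ ≤ _ := by gcongr
  have hm0 : 0 < m := by linarith
  have hā : 0 < α / m := by positivity
  have hāα : α / m ≤ α := div_le_self hα.le hm1
  have h2 : (α / m) ^ 2 * (u ⬝ᵥ D.mulVec u) ≤ α ^ 2 := by
    calc _ ≤ (α / m) ^ 2 * m ^ 2 := by gcongr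
      _ = α ^ 2 := by field_simp
  have h3 : (α / m) * (g - ε) ≤ (α / m) * (u ⬝ᵥ (x - z)) := by gcongr
  have h4 : (α / m) * ε ≤ α * ε := by gcongr
  have b1 := (inv_bounds D hD L hL hub hlb (p - z)).2
  have b2 := (inv_bounds D hD L hL hub hlb (x - z)).1
  have h5 : (p - z) ⬝ᵥ D⁻¹.mulVec (p - z) ≤ L * ((x - z) ⬝ᵥ (x - z)) - 2 * ((α / m) * g)
      + 2 * (α * ε) + α ^ 2 := by linarith
  have h6 := mul_le_mul_of_nonneg_left h5 (by linarith : 0 ≤ L)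
  have h7 : (α / m) * g ≤ L * ((α / m) * g) := le_mul_of_one_le_left (by positivity) hL
  linarith

/-- Convergence of the scaled ε-subgradient projection method with normalized
stepsizes `α_k / max(1, ‖u_k‖_{D_k})`: the iterates converge to a minimizer of
`f` over `X`. -/
theorem stmt15 {n : ℕ} (f : (Fin n → ℝ) → EReal)
    (hproper_bot : ∀ z, f z ≠ ⊥)
    (hconv : ∀ a b : Fin n → ℝ, ∀ t : ℝ, 0 ≤ t → t ≤ 1 →
      f (t • a + (1 - t) • b) ≤ ((t : ℝ) : EReal) * f a + (((1 - t : ℝ)) : EReal) * f b)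
    (hlsc : LowerSemicontinuous f)
    (X : Set (Fin n → ℝ)) (hXne : X.Nonempty) (hXcl : IsClosed X) (hXconv : Convex ℝ X)
    (hXdom : ∀ z ∈ X, f z ≠ ⊤)
    (x u : ℕ → Fin n → ℝ) (ε α L γ : ℕ → ℝ) (ρ : ℝ) (Lbd : ℝ)
    (D : ℕ → Matrix (Fin n) (Fin n) ℝ) (hD : ∀ k, (D k).PosDef)
    (hε : ∀ k, 0 ≤ ε k) (hα : ∀ k, 0 < α k)
    (hx0 : x 0 ∈ X)
    -- `u k` is an `ε k`-subgradient of `f` at `x k`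
    (hu : ∀ k, ∀ z : Fin n → ℝ,
      f (x k) + (((u k ⬝ᵥ (z - x k) - ε k : ℝ)) : EReal) ≤ f z)
    -- boundedness of the subgradients: `‖u k‖ ≤ ρ`
    (hρ : ∀ k, Real.sqrt (u k ⬝ᵥ u k) ≤ ρ)
    -- spectral bounds `‖D k‖ ≤ L k` and `‖(D k)⁻¹‖ ≤ L k`
    (hDub : ∀ k, ∀ v : Fin n → ℝ, v ⬝ᵥ (D k).mulVec v ≤ L k * (v ⬝ᵥ v))
    (hDlb : ∀ k, ∀ v : Fin n → ℝ, v ⬝ᵥ v ≤ L k * (v ⬝ᵥ (D k).mulVec v))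
    -- `L k = √(1 + γ k) ≤ Lbd`, `∑ γ k < ∞`
    (hLγ : ∀ k, L k = Real.sqrt (1 + γ k)) (hγ : ∀ k, 0 ≤ γ k)
    (hLbd : ∀ k, L k ≤ Lbd) (hγsum : Summable γ)
    -- `x (k+1)` is the scaled projection of
    -- `x k - (α k / max(1, ‖u k‖_{D k})) • D k u k` onto `X`
    (hproj : ∀ k, x (k + 1) ∈ X ∧ ∀ w ∈ X,
      ((x k - (α k / max 1 (Real.sqrt (u k ⬝ᵥ (D k).mulVec (u k)))) •
            (D k).mulVec (u k)) - x (k + 1)) ⬝ᵥ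
          (D k)⁻¹.mulVec ((x k - (α k / max 1 (Real.sqrt (u k ⬝ᵥ (D k).mulVec (u k)))) •
            (D k).mulVec (u k)) - x (k + 1))
        ≤ ((x k - (α k / max 1 (Real.sqrt (u k ⬝ᵥ (D k).mulVec (u k)))) •
            (D k).mulVec (u k)) - w) ⬝ᵥ
            (D k)⁻¹.mulVec ((x k - (α k / max 1 (Real.sqrt (u k ⬝ᵥ (D k).mulVec (u k)))) •
              (D k).mulVec (u k)) - w))
    -- conditions on the parameter sequences
    (hεlim : Filter.Tendsto ε Filter.atTop (nhds 0))
    (hαdiv : Filter.Tendsto (fun N => ∑ k ∈ Finset.range N, α k) Filter.atTop Filter.atTop)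
    (hαsq : Summable (fun k => (α k) ^ 2))
    (hαε : Summable (fun k => α k * ε k))
    -- the solution set is nonempty
    (hXs : ∃ xs ∈ X, ∀ z ∈ X, f xs ≤ f z) :
    ∃ xstar : Fin n → ℝ, xstar ∈ X ∧ (∀ z ∈ X, f xstar ≤ f z) ∧
      Filter.Tendsto x Filter.atTop (nhds xstar) := by
  obtain ⟨xs, hxs, hmin⟩ := hXs
  have hxX : ∀ k, x k ∈ X := by
    intro k
    cases k with
    | zero => exact hx0
    | succ k => exact (hproj k).1
  have hreal : ∀ z ∈ X, f z = ((f z).toReal : EReal) := fun z hz =>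
    (EReal.coe_toReal (hXdom z hz) (hproper_bot z)).symm
  set m : ℕ → ℝ := fun k => max 1 (Real.sqrt (u k ⬝ᵥ (D k).mulVec (u k))) with hm
  set g : ℕ → ℝ := fun k => (f (x k)).toReal - (f xs).toReal with hgdef
  have hg : ∀ k, 0 ≤ g k := by
    intro k
    have := hmin _ (hxX k)
    rw [hreal _ hxs, hreal _ (hxX k), EReal.coe_le_coe_iff] at this
    simp only [hgdef]; linarith
  have hL1 : ∀ k, 1 ≤ L k := by
    intro k
    rw [hLγ, Real.one_le_sqrt]; linarith [hγ k]
  have hLsq : ∀ k, L k ^ 2 = 1 + γ k := by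
    intro k
    rw [hLγ, Real.sq_sqrt]; linarith [hγ k]
  have hLb1 : 1 ≤ Lbd := (hL1 0).trans (hLbd 0)
  have hm1 : ∀ k, 1 ≤ m k := fun k => le_max_left _ _
  obtain ⟨C, hC0, hC⟩ : ∃ C, 0 < C ∧ ∀ k, m k ≤ C := by
    refine ⟨max 1 (Real.sqrt (Lbd * ρ ^ 2)), by positivity, fun k => ?_⟩
    refine max_le_max le_rfl (Real.sqrt_le_sqrt ?_)
    have h0 : 0 ≤ u k ⬝ᵥ u k := by simpa using dotProduct_star_self_nonneg (u k)
    have h1 : u k ⬝ᵥ u k ≤ ρ ^ 2 := by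
      calc _ = Real.sqrt (u k ⬝ᵥ u k) ^ 2 := (Real.sq_sqrt h0).symm
        _ ≤ _ := by
          have := hρ k
          gcongr
    calc _ ≤ L k * (u k ⬝ᵥ u k) := hDub k _
      _ ≤ Lbd * ρ ^ 2 := mul_le_mul (hLbd k) h1 h0 (by linarith)
  have main : ∀ z ∈ X, (∀ w ∈ X, f z ≤ f w) →
      (∃ l, Filter.Tendsto (fun k => (x k - z) ⬝ᵥ (x k - z)) Filter.atTop (nhds l)) ∧
      Summable (fun k => 2 * (α k / m k) * g k) := by
    intro z hz hzmin
    have hfz : f z = f xs := le_antisymm (hzmin _ hxs) (hmin _ hz)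
    apply rs_conv _ _ γ (fun k => Lbd * (2 * (α k * ε k) + α k ^ 2))
    · intro k; simpa using dotProduct_star_self_nonneg (x k - z)
    · intro k
      have := hg k
      have := hα k
      have := hm1 k
      positivity
    · exact hγ
    · intro k
      have := hα k
      have := hε k
      positivity
    · exact hγsum
    · exact ((hαε.mul_left 2).add hαsq).mul_left Lbd
    · intro k
      have hsub : g k - ε k ≤ u k ⬝ᵥ (x k - z) := by
        have h1 := hu k z
        rw [hfz, hreal _ hxs, hreal _ (hxX k), ← EReal.coe_add, EReal.coe_le_coe_iff] at h1
        have h2 : u k ⬝ᵥ (z - x k) = - (u k ⬝ᵥ (x k - z)) := by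
          rw [← neg_sub, dotProduct_neg]
        simp only [hgdef]; linarith
      have h3 := step_ineq (D k) (hD k) (L k) (hL1 k) (hDub k) (hDlb k) X hXconv (x k) (u k)
        (x (k + 1)) z (hproj k).1 hz (α k) (m k) (ε k) (g k) (hα k) rfl (hg k) (hε k) hsub
        (hproj k).2
      rw [hLsq] at h3
      have h4 : L k * (2 * (α k * ε k) + α k ^ 2) ≤ Lbd * (2 * (α k * ε k) + α k ^ 2) := by
        have := hα k
        have := hε k
        exact mul_le_mul_of_nonneg_right (hLbd k) (by positivity)
      linarith
  obtain ⟨⟨l, hl⟩, hsum⟩ := main xs hxs hmin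
  have hsum2 : Summable (fun k => α k * g k) := by
    refine Summable.of_nonneg_of_le (fun k => mul_nonneg (hα k).le (hg k)) (fun k => ?_)
      (hsum.mul_left (C / 2))
    have h1 : α k ≤ C * (α k / m k) := by
      have := hα k
      have := hm1 k
      rw [mul_div_assoc', le_div_iff₀ (by linarith), mul_comm]
      exact mul_le_mul_of_nonneg_right (hC k) (by positivity)
    have := mul_le_mul_of_nonneg_right h1 (hg k)
    calc _ ≤ _ := this
      _ = _ := by ring
  have hfr : ∀ i : ℕ, ∃ k, i ≤ k ∧ g k < 1 / ((i : ℝ) + 1) := fun i =>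
    freq_small α g hα hg hαdiv hsum2 _ (by positivity) i
  choose φ hφ hφg using hfr
  have hφt : Filter.Tendsto φ Filter.atTop Filter.atTop :=
    Filter.tendsto_atTop_mono hφ Filter.tendsto_id
  -- norm control
  have hnorm : ∀ v : Fin n → ℝ, ‖v‖ ≤ Real.sqrt (v ⬝ᵥ v) := by
    intro v
    rw [pi_norm_le_iff_of_nonneg (Real.sqrt_nonneg _)]
    intro i
    apply Real.le_sqrt_of_sq_le
    rw [Real.norm_eq_abs, sq_abs, sq]
    exact Finset.single_le_sum (f := fun i => v i * v i) (fun i _ => mul_self_nonneg _)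
      (Finset.mem_univ i)
  obtain ⟨R, hR⟩ := hl.bddAbove_range
  have hball : ∀ i, (x ∘ φ) i ∈ Metric.closedBall xs (Real.sqrt R) := by
    intro i
    rw [mem_closedBall_iff_norm]
    exact (hnorm _).trans (Real.sqrt_le_sqrt (hR ⟨φ i, rfl⟩))
  obtain ⟨xst, -, ψ, hψ, hlim⟩ := (isCompact_closedBall xs (Real.sqrt R)).tendsto_subseq hball
  have hxstX : xst ∈ X := hXcl.mem_of_tendsto hlim (Filter.Eventually.of_forall fun i => hxX _)
  have hφψ : Filter.Tendsto (φ ∘ ψ) Filter.atTop Filter.atTop := hφt.comp hψ.tendsto_atTop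
  have hg0 : Filter.Tendsto (fun i => g (φ (ψ i))) Filter.atTop (nhds 0) := by
    have : Filter.Tendsto (fun i => g (φ i)) Filter.atTop (nhds 0) :=
      squeeze_zero (fun i => hg _) (fun i => (hφg i).le) tendsto_one_div_add_atTop_nhds_zero_nat
    exact this.comp hψ.tendsto_atTop
  have hle : f xst ≤ f xs := by
    by_contra! hcon
    obtain ⟨c, hc1, hc2⟩ := EReal.exists_between_coe_real hcon
    have h1 := hlim.eventually (hlsc xst c hc2)
    rw [hreal _ hxs, EReal.coe_lt_coe_iff] at hc1
    have h2 := hg0.eventually (gt_mem_nhds (sub_pos.2 hc1))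
    obtain ⟨i, hi1, hi2⟩ := (h1.and h2).exists
    simp only [Function.comp] at hi1
    rw [gt_iff_lt, hreal _ (hxX _), EReal.coe_lt_coe_iff] at hi1
    simp only [hgdef] at hi2
    linarith
  have hxmin : ∀ z ∈ X, f xst ≤ f z := fun z hz => hle.trans (hmin z hz)
  refine ⟨xst, hxstX, hxmin, ?_⟩
  obtain ⟨⟨l', hl'⟩, -⟩ := main xst hxstX hxmin
  have hl0 : l' = 0 := by
    have h1 := hl'.comp hφψ
    have hcont : Continuous (fun v : Fin n → ℝ => (v - xst) ⬝ᵥ (v - xst)) := by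
      unfold dotProduct; fun_prop
    have h2 := (hcont.tendsto xst).comp hlim
    simp only [sub_self, dotProduct_zero] at h2
    exact tendsto_nhds_unique h1 h2
  subst hl0
  rw [tendsto_iff_norm_sub_tendsto_zero]
  refine squeeze_zero (fun _ => norm_nonneg _) (fun k => hnorm _) ?_
  simpa using hl'.sqrt
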